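/- arXiv:2311.08763 — 2 statements merged into one kernel-verified Lean document; each statement's English description precedes it below -/
import Mathlib

section
/- Let E be a measurable space, p ∈ (0,1), α a finite measure on E, and let φ, θ : E → ℂ be bounded measurable. Then for every bounded measurable F : Conf(E) → ℂ and every finite configuration η: (k⁰(θ)(k⁺(φ)F))(η) − (k⁺(φ)(k⁰(θ)F))(η) = (k⁺(φ·θ)F)(η), and (k⁰(θ)(k⁻(φ)F))(η) − (k⁻(φ)(k⁰(θ)F))(η) = −√p (∫_E conj(φ(x))θ(x) F(η+x) α(dx) + ∑_{x∈η} conj(φ(x))θ(x) F(η+x)) = −(k⁻(φ·conj(θ))F)(η). -/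
open MeasureTheory Complex

noncomputable section

variable {E : Type*}

/-- Number of points of the finite configuration `η` lying in `B`, counted with multiplicity. -/
def confCount (η : Multiset E) (B : Set E) : ℕ :=
  @Multiset.countP E (fun x => x ∈ B) (Classical.decPred _) η

/-- Removal of one copy of the point `x` from the configuration `η`. -/
def confDel (η : Multiset E) (x : E) : Multiset E :=
  @Multiset.erase E (Classical.decEq E) η x

/-- The σ-algebra on the configuration space generated by the counting maps `η ↦ η(B)`,
`B` measurable. -/
instance confMeasurableSpace [MeasurableSpace E] : MeasurableSpace (Multiset E) :=
  MeasurableSpace.generateFrom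
    {S | ∃ (B : Set E) (n : ℕ), MeasurableSet B ∧ S = {η | confCount η B = n}}

/-- The raising operator `k⁺(φ)`. -/
def kplus (p : ℝ) (φ : E → ℂ) (F : Multiset E → ℂ) (η : Multiset E) : ℂ :=
  (Real.sqrt p : ℂ)⁻¹ * (η.map (fun x => φ x * F (confDel η x))).sum

/-- The lowering operator `k⁻(φ)`. -/
def kminus (p : ℝ) [MeasurableSpace E] (α : Measure E) (φ : E → ℂ) (F : Multiset E → ℂ)
    (η : Multiset E) : ℂ :=
  (Real.sqrt p : ℂ) * ((∫ x, (starRingEnd ℂ) (φ x) * F (x ::ₘ η) ∂α) +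
    (η.map (fun x => (starRingEnd ℂ) (φ x) * F (x ::ₘ η))).sum)

/-- The neutral operator `k⁰(φ)`. -/
def kzero [MeasurableSpace E] (α : Measure E) (φ : E → ℂ) (F : Multiset E → ℂ)
    (η : Multiset E) : ℂ :=
  F η * ((η.map φ).sum + (1 / 2 : ℂ) * ∫ x, φ x ∂α)


/-- Adding a point to a configuration is measurable in that point. -/
theorem measurable_cons_conf [MeasurableSpace E] (η : Multiset E) :
    Measurable (fun x : E => x ::ₘ η) := by
  refine measurable_generateFrom ?_
  rintro _ ⟨B, n, hB, rfl⟩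
  classical
  have h : (fun x : E => x ::ₘ η) ⁻¹' {η | confCount η B = n}
      = {x | confCount η B + (if x ∈ B then 1 else 0) = n} := by
    ext x
    simp only [Set.mem_preimage, Set.mem_ofPred_eq, confCount]
    rw [Multiset.countP_cons]
  rw [h]
  exact (measurable_const.add (Measurable.ite hB measurable_const measurable_const))
    (measurableSet_singleton n)

theorem sum_map_confDel (θ : E → ℂ) {η : Multiset E} {x : E} (hx : x ∈ η) :
    ((confDel η x).map θ).sum = (η.map θ).sum - θ x := by
  classical
  have h : x ::ₘ confDel η x = η := by
    unfold confDel
    exact @Multiset.cons_erase E (Classical.decEq E) η x hx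
  conv_rhs => rw [← h]
  simp

theorem kzero_kplus_commutator [MeasurableSpace E] (p : ℝ) (α : Measure E) (φ θ : E → ℂ)
    (F : Multiset E → ℂ) (η : Multiset E) :
    kzero α θ (kplus p φ F) η - kplus p φ (kzero α θ F) η
      = kplus p (fun x => φ x * θ x) F η := by
  set c : ℂ := (η.map θ).sum + (1 / 2 : ℂ) * ∫ x, θ x ∂α with hc
  have h : η.map (fun x => φ x * kzero α θ F (confDel η x))
      = η.map (fun x => φ x * F (confDel η x) * c - φ x * θ x * F (confDel η x)) := by
    refine Multiset.map_congr rfl fun x hx => ?_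
    rw [kzero, sum_map_confDel θ hx, hc]
    ring
  simp only [kplus, h, Multiset.sum_map_sub, Multiset.sum_map_mul_right]
  rw [kzero, ← hc, kplus]
  ring

theorem integrable_mul_cons_conf [MeasurableSpace E] (α : Measure E) [IsFiniteMeasure α]
    {ψ : E → ℂ} (hψ : Measurable ψ) (hψb : ∃ C, ∀ x, ‖ψ x‖ ≤ C)
    {F : Multiset E → ℂ} (hF : Measurable F) (hFb : ∃ C, ∀ η, ‖F η‖ ≤ C) (η : Multiset E) :
    Integrable (fun x => ψ x * F (x ::ₘ η)) α := by
  obtain ⟨C, hC⟩ := hψb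
  obtain ⟨D, hD⟩ := hFb
  refine Integrable.of_bound
    (hψ.mul (hF.comp (measurable_cons_conf η))).aestronglyMeasurable (C * D)
    (Filter.Eventually.of_forall fun x => ?_)
  rw [norm_mul]
  exact mul_le_mul (hC x) (hD _) (norm_nonneg _) ((norm_nonneg _).trans (hC x))

theorem kzero_kminus_commutator [MeasurableSpace E] (p : ℝ) (α : Measure E) [IsFiniteMeasure α]
    {φ θ : E → ℂ} (hφ : Measurable φ) (hφb : ∃ C, ∀ x, ‖φ x‖ ≤ C)
    (hθ : Measurable θ) (hθb : ∃ C, ∀ x, ‖θ x‖ ≤ C)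
    {F : Multiset E → ℂ} (hF : Measurable F) (hFb : ∃ C, ∀ η, ‖F η‖ ≤ C) (η : Multiset E) :
    kzero α θ (kminus p α φ F) η - kminus p α φ (kzero α θ F) η
      = -((Real.sqrt p : ℂ) *
          ((∫ x, (starRingEnd ℂ) (φ x) * θ x * F (x ::ₘ η) ∂α) +
            (η.map (fun x => (starRingEnd ℂ) (φ x) * θ x * F (x ::ₘ η))).sum)) := by
  set c : ℂ := (η.map θ).sum + (1 / 2 : ℂ) * ∫ x, θ x ∂α with hc
  have hφ' : Measurable fun x => (starRingEnd ℂ) (φ x) :=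
    Complex.continuous_conj.measurable.comp hφ
  obtain ⟨C, hC⟩ := hφb
  obtain ⟨D, hD⟩ := hθb
  have hconj : ∀ x, ‖(starRingEnd ℂ) (φ x)‖ ≤ C := fun x => by simpa using hC x
  have hint : Integrable (fun x => (starRingEnd ℂ) (φ x) * F (x ::ₘ η)) α :=
    integrable_mul_cons_conf α hφ' ⟨C, hconj⟩ hF hFb η
  have hint' : Integrable (fun x => (starRingEnd ℂ) (φ x) * θ x * F (x ::ₘ η)) α := by
    refine integrable_mul_cons_conf α (hφ'.mul hθ) ⟨C * D, fun x => ?_⟩ hF hFb η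
    rw [Pi.mul_apply, norm_mul]
    exact mul_le_mul (hconj x) (hD x) (norm_nonneg _) ((norm_nonneg _).trans (hC x))
  have h : (fun x => (starRingEnd ℂ) (φ x) * kzero α θ F (x ::ₘ η))
      = fun x => (starRingEnd ℂ) (φ x) * F (x ::ₘ η) * c
        + (starRingEnd ℂ) (φ x) * θ x * F (x ::ₘ η) := by
    funext x
    rw [kzero, Multiset.map_cons, Multiset.sum_cons, hc]
    ring
  simp only [kminus, h, Multiset.sum_map_add, Multiset.sum_map_mul_right]
  rw [integral_add (hint.mul_const c) hint', integral_mul_const, kzero, ← hc, kminus]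
  ring

/-- the commutator relations `[k⁰(θ), k⁺(φ)] = k⁺(φ·θ)` and
`[k⁰(θ), k⁻(φ)] = −k⁻(φ·conj(θ))`, the latter with its explicit integral form. -/
theorem commutator_kzero_kpm [MeasurableSpace E] (p : ℝ) (hp : p ∈ Set.Ioo (0 : ℝ) 1)
    (α : Measure E) [IsFiniteMeasure α]
    (φ θ : E → ℂ) (hφ : Measurable φ) (hφb : ∃ C, ∀ x, ‖φ x‖ ≤ C)
    (hθ : Measurable θ) (hθb : ∃ C, ∀ x, ‖θ x‖ ≤ C)
    (F : Multiset E → ℂ) (hF : Measurable F) (hFb : ∃ C, ∀ η, ‖F η‖ ≤ C)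
    (η : Multiset E) :
    kzero α θ (kplus p φ F) η - kplus p φ (kzero α θ F) η
        = kplus p (fun x => φ x * θ x) F η
      ∧ kzero α θ (kminus p α φ F) η - kminus p α φ (kzero α θ F) η
        = -((Real.sqrt p : ℂ) *
            ((∫ x, (starRingEnd ℂ) (φ x) * θ x * F (x ::ₘ η) ∂α) +
              (η.map (fun x => (starRingEnd ℂ) (φ x) * θ x * F (x ::ₘ η))).sum))
      ∧ -((Real.sqrt p : ℂ) *
            ((∫ x, (starRingEnd ℂ) (φ x) * θ x * F (x ::ₘ η) ∂α) +
              (η.map (fun x => (starRingEnd ℂ) (φ x) * θ x * F (x ::ₘ η))).sum))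
        = -(kminus p α (fun x => φ x * (starRingEnd ℂ) (θ x)) F η) := by
  refine ⟨kzero_kplus_commutator p α φ θ F η,
    kzero_kminus_commutator p α hφ hφb hθ hθb hF hFb η, ?_⟩
  simp only [kminus, map_mul, Complex.conj_conj]
end
end

section
/- Let E be a measurable space, p ∈ (0,1), α a finite measure on E, and let ρ be a probability measure on Conf(E) satisfying the Papangelou identity for parameters (p, α). Then for every bounded measurable φ : E → ℂ and all f, g ∈ 𝒟, ∫ conj(f(η)) · (k⁺(φ)g)(η) ρ(dη) = ∫ conj((k⁻(φ)f)(η)) · g(η) ρ(dη); that is, k⁺(φ) and k⁻(φ) are adjoint to each other on 𝒟 in L²(ρ). -/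
open MeasureTheory Complex
open scoped ENNReal

noncomputable section

variable {E : Type*}

/-- `ρ` satisfies the Papangelou identity with kernel `p(α + η)`. -/
def Papangelou [MeasurableSpace E] (p : ℝ) (α : Measure E) (ρ : Measure (Multiset E)) : Prop :=
  ∀ F : E × Multiset E → ℝ≥0∞, Measurable F →
    ∫⁻ η, (η.map (fun x => F (x, η))).sum ∂ρ
      = ENNReal.ofReal p *
          ∫⁻ η, ((∫⁻ x, F (x, x ::ₘ η) ∂α) + (η.map (fun x => F (x, x ::ₘ η))).sum) ∂ρ

/-- The set `𝒟` of bounded measurable functions supported on configurations with a bounded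
number of points. -/
def memD [MeasurableSpace E] (f : Multiset E → ℂ) : Prop :=
  Measurable f ∧ (∃ C, ∀ η, ‖f η‖ ≤ C) ∧ ∃ m : ℕ, ∀ η : Multiset E, m < Multiset.card η → f η = 0

theorem confCount_cons (x : E) (η : Multiset E) (B : Set E) :
    confCount (x ::ₘ η) B = confCount η B + B.indicator 1 x := by
  classical
  simp [confCount, Multiset.countP_cons, Set.indicator_apply]

theorem cons_confDel {x : E} {η : Multiset E} (hx : x ∈ η) : x ::ₘ confDel η x = η := by
  classical
  exact Multiset.cons_erase hx

section CountingKernel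

open ProbabilityTheory

variable [MeasurableSpace E]

theorem measurable_confCount {B : Set E} (hB : MeasurableSet B) :
    Measurable fun η : Multiset E => confCount η B :=
  measurable_to_countable' fun n =>
    MeasurableSpace.measurableSet_generateFrom ⟨B, n, hB, rfl⟩

/-- A map into the configuration space is measurable if all its point counts are. -/
theorem measurable_of_confCount {X : Type*} [MeasurableSpace X] {h : X → Multiset E}
    (hh : ∀ B, MeasurableSet B → Measurable fun a => confCount (h a) B) : Measurable h := by
  refine measurable_generateFrom ?_
  rintro _ ⟨B, n, hB, rfl⟩
  exact hh B hB (measurableSet_singleton n)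

theorem measurable_card_conf : Measurable fun η : Multiset E => Multiset.card η := by
  simpa [confCount] using measurable_confCount (E := E) MeasurableSet.univ

/-- Adding a point to a configuration while remembering which point was added. -/
def confAdd (q : Multiset E × E) : Multiset E × E :=
  (q.2 ::ₘ q.1, q.2)

theorem measurable_confAdd : Measurable (confAdd (E := E)) := by
  refine (measurable_of_confCount fun B hB => ?_).prodMk measurable_snd
  simp_rw [confCount_cons]
  exact ((measurable_confCount hB).comp measurable_fst).add
    ((measurable_one.indicator hB).comp measurable_snd)

/-- A measurable function of the configuration before adding a point is a measurable function of
the configuration after adding it together with the added point. -/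
theorem exists_measurable_confAdd {g : Multiset E → ℂ} (hg : Measurable g) :
    ∃ G : Multiset E × E → ℂ, Measurable G ∧ ∀ q, G (confAdd q) = g q.1 := by
  have hfst : Measurable[MeasurableSpace.comap confAdd inferInstance]
      (Prod.fst : Multiset E × E → Multiset E) := by
    refine @measurable_of_confCount _ _ _ (MeasurableSpace.comap confAdd inferInstance) _
      fun B hB => ?_
    have hsub : Measurable fun q : Multiset E × E => confCount q.1 B - B.indicator 1 q.2 :=
      ((measurable_confCount hB).comp measurable_fst).sub
        ((measurable_one.indicator hB).comp measurable_snd)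
    have hcomp := hsub.comp (comap_measurable (confAdd (E := E)))
    convert hcomp using 2 with q
    simp [confAdd, confCount_cons]
  obtain ⟨G, hG, h⟩ := (hg.comp hfst).exists_eq_measurable_comp
  exact ⟨G, hG, fun q => (congrFun h q).symm⟩

/-- A configuration regarded as a measure. -/
def confMeasure (η : Multiset E) : Measure E :=
  (η.map Measure.dirac).sum

@[simp]
theorem confMeasure_zero : confMeasure (0 : Multiset E) = 0 := rfl

@[simp]
theorem confMeasure_cons (x : E) (η : Multiset E) :
    confMeasure (x ::ₘ η) = Measure.dirac x + confMeasure η := by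
  simp [confMeasure]

theorem confMeasure_apply (η : Multiset E) {B : Set E} (hB : MeasurableSet B) :
    confMeasure η B = confCount η B := by
  classical
  induction η using Multiset.induction with
  | empty => simp [confCount]
  | cons x η ih =>
    rw [confMeasure_cons, confCount_cons, Measure.add_apply, ih, Measure.dirac_apply' _ hB,
      add_comm]
    by_cases hx : x ∈ B <;> simp [hx]

theorem confMeasure_univ (η : Multiset E) : confMeasure η Set.univ = Multiset.card η := by
  simp [confMeasure_apply η MeasurableSet.univ, confCount]

instance isFiniteMeasure_confMeasure (η : Multiset E) : IsFiniteMeasure (confMeasure η) :=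
  ⟨by simp [confMeasure_univ]⟩

theorem lintegral_confMeasure (η : Multiset E) {F : E → ℝ≥0∞} (hF : Measurable F) :
    ∫⁻ x, F x ∂confMeasure η = (η.map F).sum := by
  induction η using Multiset.induction with
  | empty => simp
  | cons x η ih => simp [lintegral_add_measure, lintegral_dirac' x hF, ih]

theorem integrable_confMeasure (η : Multiset E) {F : E → ℂ} (hF : Measurable F) :
    Integrable F (confMeasure η) := by
  induction η using Multiset.induction with
  | empty => simp
  | cons x η ih =>
    rw [confMeasure_cons]
    exact (integrable_dirac' hF.stronglyMeasurable (by simp)).add_measure ih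

theorem integral_confMeasure (η : Multiset E) {F : E → ℂ} (hF : Measurable F) :
    ∫ x, F x ∂confMeasure η = (η.map F).sum := by
  induction η using Multiset.induction with
  | empty => simp
  | cons x η ih =>
    rw [confMeasure_cons, integral_add_measure
      (integrable_dirac' hF.stronglyMeasurable (by simp)) (integrable_confMeasure η hF),
      integral_dirac' _ _ hF.stronglyMeasurable, ih]
    simp

/-- The kernel sending a configuration to the associated counting measure. -/
def confKernel : Kernel (Multiset E) E where
  toFun := confMeasure
  measurable' := by
    refine Measure.measurable_of_measurable_coe _ fun B hB => ?_
    simp_rw [confMeasure_apply _ hB]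
    exact measurable_from_top.comp (measurable_confCount hB)

@[simp]
theorem confKernel_apply (η : Multiset E) : confKernel η = confMeasure η := rfl

instance isSFiniteKernel_confKernel : IsSFiniteKernel (confKernel (E := E)) := by
  classical
  have hs (n : ℕ) : MeasurableSet {η : Multiset E | Multiset.card η = n} :=
    measurable_card_conf (measurableSet_singleton n)
  refine ⟨⟨fun n => Kernel.piecewise (hs n) confKernel 0, fun n => ⟨n, by simp, fun η => ?_⟩, ?_⟩⟩
  · rw [Kernel.piecewise_apply]
    split_ifs with h
    · exact (confMeasure_univ η).trans_le (by simpa using le_of_eq h)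
    · simp
  · ext η B hB
    rw [Kernel.sum_apply' _ _ hB, tsum_eq_single (Multiset.card η)]
    · simp [Kernel.piecewise_apply]
    · intro n hn
      simp [Kernel.piecewise_apply, hn.symm]

/-- The Papangelou kernel `α + η`, without the factor `p`. -/
def papangelouKernel (α : Measure E) : Kernel (Multiset E) E :=
  Kernel.const _ α + confKernel

instance isSFiniteKernel_papangelouKernel (α : Measure E) [IsFiniteMeasure α] :
    IsSFiniteKernel (papangelouKernel α) :=
  inferInstanceAs (IsSFiniteKernel (Kernel.const _ α + confKernel))

theorem papangelouKernel_apply (α : Measure E) (η : Multiset E) :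
    papangelouKernel α η = α + confMeasure η := by
  simp [papangelouKernel]

/-- The Papangelou identity as an equality of measures on pairs (configuration, point). -/
theorem Papangelou.compProd_eq {p : ℝ} {α : Measure E} [IsFiniteMeasure α]
    {ρ : Measure (Multiset E)} [IsProbabilityMeasure ρ] (hρ : Papangelou p α ρ) :
    ρ ⊗ₘ confKernel
      = ENNReal.ofReal p • (ρ ⊗ₘ papangelouKernel α).map confAdd := by
  refine Measure.ext_of_lintegral _ fun F hF => ?_
  rw [lintegral_smul_measure, lintegral_map hF measurable_confAdd,
    Measure.lintegral_compProd hF, Measure.lintegral_compProd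
      (f := fun q => F (confAdd q)) (hF.comp measurable_confAdd)]
  convert hρ (fun q => F q.swap) (hF.comp measurable_swap) using 3 with η
  · exact lintegral_confMeasure η (hF.comp measurable_prodMk_left)
  · rw [smul_eq_mul]
    congr 2 with η
    rw [papangelouKernel_apply, lintegral_add_measure,
      lintegral_confMeasure η (F := fun x => F (confAdd (η, x)))
        (hF.comp (measurable_confAdd.comp measurable_prodMk_left))]
    rfl

/-- A bounded measurable function supported on configurations with at most `m` points is
integrable with respect to the Papangelou kernel. -/
theorem integrable_compProd_papangelouKernel (α : Measure E) [IsFiniteMeasure α]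
    (ρ : Measure (Multiset E)) [IsProbabilityMeasure ρ] {H : Multiset E × E → ℂ}
    (hH : Measurable H) {C : ℝ} (hC : ∀ q, ‖H q‖ ≤ C) {m : ℕ}
    (hm : ∀ q, m < Multiset.card q.1 → H q = 0) :
    Integrable H (ρ ⊗ₘ papangelouKernel α) := by
  refine ⟨hH.aestronglyMeasurable, ?_⟩
  rw [HasFiniteIntegral, Measure.lintegral_compProd hH.enorm]
  have hbound (η : Multiset E) :
      ∫⁻ x, ‖H (η, x)‖ₑ ∂papangelouKernel α η ≤ ENNReal.ofReal C * (α Set.univ + m) := by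
    by_cases hη : m < Multiset.card η
    · simp [hm (η, _) hη]
    · calc ∫⁻ x, ‖H (η, x)‖ₑ ∂papangelouKernel α η
          ≤ ∫⁻ _, ENNReal.ofReal C ∂papangelouKernel α η := by
            refine lintegral_mono fun x => ?_
            rw [← ofReal_norm]
            exact ENNReal.ofReal_le_ofReal (hC _)
        _ ≤ ENNReal.ofReal C * (α Set.univ + m) := by
            rw [lintegral_const, papangelouKernel_apply, Measure.add_apply, confMeasure_univ]
            gcongr
            exact not_lt.mp hη
  refine (lintegral_mono hbound).trans_lt ?_
  rw [lintegral_const]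
  finiteness

theorem kminus_eq_integral (p : ℝ) (α : Measure E) [IsFiniteMeasure α] {φ : E → ℂ}
    (hφ : Measurable φ) {Cφ : ℝ} (hCφ : ∀ x, ‖φ x‖ ≤ Cφ) {f : Multiset E → ℂ} (hf : Measurable f)
    {Cf : ℝ} (hCf : ∀ η, ‖f η‖ ≤ Cf) (η : Multiset E) :
    kminus p α φ f η = (Real.sqrt p : ℂ) *
      ∫ x, (starRingEnd ℂ) (φ x) * f (x ::ₘ η) ∂papangelouKernel α η := by
  have hmeas : Measurable fun x => (starRingEnd ℂ) (φ x) * f (x ::ₘ η) :=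
    (continuous_conj.measurable.comp hφ).mul
      (hf.comp (measurable_fst.comp (measurable_confAdd.comp measurable_prodMk_left)))
  have hInt : Integrable (fun x => (starRingEnd ℂ) (φ x) * f (x ::ₘ η)) α := by
    refine Integrable.of_bound hmeas.aestronglyMeasurable (Cφ * Cf) (.of_forall fun x => ?_)
    rw [norm_mul, RCLike.norm_conj]
    exact mul_le_mul (hCφ x) (hCf _) (norm_nonneg _) ((norm_nonneg _).trans (hCφ x))
  rw [papangelouKernel_apply, integral_add_measure hInt (integrable_confMeasure η hmeas),
    integral_confMeasure η hmeas, kminus]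

end CountingKernel

/-- `k⁺(φ)` and `k⁻(φ)` are adjoint to each other on `𝒟` in `L²(ρ)`. -/
theorem kplus_kminus_adjoint [MeasurableSpace E] (p : ℝ) (hp : p ∈ Set.Ioo (0 : ℝ) 1)
    (α : Measure E) [IsFiniteMeasure α] (ρ : Measure (Multiset E)) [IsProbabilityMeasure ρ]
    (hρ : Papangelou p α ρ)
    (φ : E → ℂ) (hφ : Measurable φ) (hφb : ∃ C, ∀ x, ‖φ x‖ ≤ C)
    (f g : Multiset E → ℂ) (hf : memD f) (hg : memD g) :
    ∫ η, (starRingEnd ℂ) (f η) * kplus p φ g η ∂ρ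
      = ∫ η, (starRingEnd ℂ) (kminus p α φ f η) * g η ∂ρ := by
  obtain ⟨Cφ, hCφ⟩ := hφb
  obtain ⟨hfm, ⟨Cf, hCf⟩, -⟩ := hf
  obtain ⟨hgm, ⟨Cg, hCg⟩, m, hm⟩ := hg
  obtain ⟨G, hGm, hG⟩ := exists_measurable_confAdd hgm
  let H : Multiset E × E → ℂ := fun q => (starRingEnd ℂ) (f q.1) * (φ q.2 * G q)
  have hH : Measurable H :=
    (continuous_conj.measurable.comp (hfm.comp measurable_fst)).mul
      ((hφ.comp measurable_snd).mul hGm)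
  have hHadd (q) : H (confAdd q) = (starRingEnd ℂ) (f (q.2 ::ₘ q.1)) * (φ q.2 * g q.1) := by
    simp only [H, hG]
    rfl
  have hInt : Integrable (fun q => H (confAdd q)) (ρ.compProd (papangelouKernel α)) := by
    refine integrable_compProd_papangelouKernel α ρ (hH.comp measurable_confAdd)
      (C := Cf * (Cφ * Cg)) (m := m) (fun q => ?_) fun q hq => ?_
    · have h1 := hCφ q.2
      have h2 := hCf (q.2 ::ₘ q.1)
      have h3 := hCg q.1
      rw [hHadd, norm_mul, norm_mul, RCLike.norm_conj]
      have := (norm_nonneg _).trans h1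
      have := (norm_nonneg _).trans h2
      gcongr
    · simp [hHadd, hm _ hq]
  have hInt_map : Integrable H ((ρ.compProd (papangelouKernel α)).map confAdd) :=
    (integrable_map_measure hH.aestronglyMeasurable measurable_confAdd.aemeasurable).mpr hInt
  have hInt_conf : Integrable H (ρ.compProd confKernel) := by
    rw [hρ.compProd_eq]
    exact hInt_map.smul_measure ENNReal.ofReal_ne_top
  have hplus (η : Multiset E) : (starRingEnd ℂ) (f η) * kplus p φ g η
      = (Real.sqrt p : ℂ)⁻¹ * ∫ x, H (η, x) ∂confKernel η := by
    rw [confKernel_apply, integral_confMeasure η (F := fun x => H (η, x))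
      (hH.comp measurable_prodMk_left), kplus, mul_left_comm,
      ← Multiset.sum_map_mul_left]
    congr 2
    refine Multiset.map_congr rfl fun x hx => ?_
    have h := hG (confDel η x, x)
    rw [confAdd, cons_confDel hx] at h
    simp only [H, h]
  have hminus (η : Multiset E) : (starRingEnd ℂ) (kminus p α φ f η) * g η
      = (Real.sqrt p : ℂ) * ∫ x, H (confAdd (η, x)) ∂papangelouKernel α η := by
    rw [kminus_eq_integral p α hφ hCφ hfm hCf, map_mul, conj_ofReal, ← integral_conj, mul_assoc,
      ← integral_mul_const]
    congr 2
    ext x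
    simp only [hHadd, map_mul, conj_conj]
    ring
  simp_rw [hplus, hminus, integral_const_mul]
  rw [← Measure.integral_compProd hInt_conf, ← Measure.integral_compProd hInt, hρ.compProd_eq,
    integral_smul_measure, integral_map measurable_confAdd.aemeasurable hH.aestronglyMeasurable,
    ENNReal.toReal_ofReal hp.1.le, real_smul, ← mul_assoc]
  congr 1
  have hsqrt : (Real.sqrt p : ℂ) ≠ 0 := by
    exact_mod_cast (Real.sqrt_pos.mpr hp.1).ne'
  rw [inv_mul_eq_iff_eq_mul₀ hsqrt]
  exact_mod_cast (Real.mul_self_sqrt hp.1.le).symm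
end
end
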